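/- Let E be a finite-dimensional real inner product space, let h : E → ℝ be differentiable with gradient ∇h that is Lipschitz with constant L > 0 on E, let f : E → ℝ be lower semicontinuous and bounded below, and let c > L. Fix x ∈ E and suppose x⁺ ∈ E minimizes the function u ↦ f(u) + ⟨∇h(x), u − x⟩ + (c/2)‖u − x‖² over E. Then h(x⁺) + f(x⁺) ≤ h(x) + f(x) − ((c − L)/2)‖x⁺ − x‖². -/

import Mathlib

open scoped RealInnerProductSpace

/-- **Descent lemma**: a differentiable function whose gradient is `K`-Lipschitz lies below its
linearization at `x` plus `(K / 2) * ‖y - x‖ ^ 2`. -/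
theorem LipschitzWith.le_add_inner_gradient_add_sq {E : Type*} [NormedAddCommGroup E]
    [InnerProductSpace ℝ E] [CompleteSpace E] {h : E → ℝ} {K : NNReal}
    (hlip : LipschitzWith K (gradient h)) (hdiff : Differentiable ℝ h) (x y : E) :
    h y ≤ h x + ⟪gradient h x, y - x⟫ + (K / 2) * ‖y - x‖ ^ 2 := by
  set v := y - x with hv
  have hderiv (t : ℝ) : HasDerivAt (fun s : ℝ => h (x + s • v)) ⟪gradient h (x + t • v), v⟫ t := by
    have hline : HasDerivAt (fun s : ℝ => x + s • v) v t := by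
      simpa using ((hasDerivAt_id t).smul_const v).const_add x
    have hgrad := (hdiff (x + t • v)).hasGradientAt.hasFDerivAt
    simpa [Function.comp_def] using hgrad.comp_hasDerivAt t hline
  have hbound (t : ℝ) : HasDerivAt
      (fun s : ℝ => h x + s * ⟪gradient h x, v⟫ + (K / 2) * ‖v‖ ^ 2 * s ^ 2)
      (⟪gradient h x, v⟫ + K * ‖v‖ ^ 2 * t) t := by
    refine ((((hasDerivAt_id t).mul_const ⟪gradient h x, v⟫).const_add (h x)).add
      ((hasDerivAt_pow 2 t).const_mul ((K / 2 : ℝ) * ‖v‖ ^ 2))).congr_deriv ?_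
    norm_num
    ring
  have key := image_le_of_deriv_right_le_deriv_boundary (a := 0) (b := 1)
    (fun t _ => (hderiv t).continuousAt.continuousWithinAt)
    (fun t _ => (hderiv t).hasDerivWithinAt) (by simp)
    (fun t _ => (hbound t).continuousAt.continuousWithinAt)
    (fun t _ => (hbound t).hasDerivWithinAt) ?_ (Set.right_mem_Icc.2 zero_le_one)
  · simpa [hv] using key
  · intro t ht
    have hnorm : ‖gradient h (x + t • v) - gradient h x‖ ≤ K * (t * ‖v‖) := by
      simpa [norm_smul, abs_of_nonneg ht.1] using hlip.norm_sub_le (x + t • v) x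
    have hinner := real_inner_le_norm (gradient h (x + t • v) - gradient h x) v
    rw [inner_sub_left] at hinner
    nlinarith [mul_le_mul_of_nonneg_right hnorm (norm_nonneg v)]

/-- Sufficient decrease of a proximally linearized step (Euclidean case).
If `∇h` is `L`-Lipschitz, `f` is lower semicontinuous and bounded below, `c > L`, and `x⁺`
minimizes `u ↦ f(u) + ⟨∇h(x), u − x⟩ + (c/2)‖u − x‖²`, then
`h(x⁺) + f(x⁺) ≤ h(x) + f(x) − ((c − L)/2)‖x⁺ − x‖²`. -/
theorem stmt_9 {E : Type*} [NormedAddCommGroup E] [InnerProductSpace ℝ E]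
    [FiniteDimensional ℝ E]
    (h f : E → ℝ) (L c : ℝ) (hL : 0 < L)
    (hdiff : Differentiable ℝ h)
    (hlip : LipschitzWith (Real.toNNReal L) (fun u => gradient h u))
    (hlsc : LowerSemicontinuous f) (hbdd : BddBelow (Set.range f))
    (hc : L < c) (x xp : E)
    (hmin : ∀ u : E,
      f xp + ⟪gradient h x, xp - x⟫ + (c/2) * ‖xp - x‖^2
        ≤ f u + ⟪gradient h x, u - x⟫ + (c/2) * ‖u - x‖^2) :
    h xp + f xp ≤ h x + f x - ((c - L)/2) * ‖xp - x‖^2 := by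
  have hdescent := hlip.le_add_inner_gradient_add_sq hdiff x xp
  rw [Real.coe_toNNReal L hL.le] at hdescent
  have hle := hmin x
  simp only [sub_self, inner_zero_right, norm_zero] at hle
  linarith
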